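/- Let E be a real normed vector space, I an index type, and C : I → Set E a (δ, Δ)-separated family of nonempty subsets. Let γ be a matching threshold with δ < γ and γ ≤ Δ − δ. Let P : Fin m → E be a finite family of prompt keys with cluster labels κ : Fin m → I such that P k ∈ convexHull ℝ (C (κ k)) for every k. Then for every i ∈ I and every batch statistic x ∈ C i, the set of matched keys {k : Fin m | ‖x − P k‖ < γ} equals {k : Fin m | κ k = i}. (Proposition: under the hull invariant maintained by Knowledge Fission and Fusion, threshold matching selects exactly the prompts of the batch's own cluster.) -/

import Mathlib

/-- If every point of `s` is within `δ` of `a`, so is every point of its convex hull. -/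
theorem norm_sub_le_of_mem_convexHull {E : Type*} [SeminormedAddCommGroup E] [NormedSpace ℝ E]
    {s : Set E} {a p : E} {δ : ℝ} (h : ∀ b ∈ s, ‖a - b‖ ≤ δ) (hp : p ∈ convexHull ℝ s) :
    ‖a - p‖ ≤ δ := by
  have hs : s ⊆ Metric.closedBall a δ := fun b hb =>
    mem_closedBall_iff_norm'.2 (h b hb)
  exact mem_closedBall_iff_norm'.1 (convexHull_min hs (convex_closedBall a δ) hp)

/-- Proposition: Under the hull invariant maintained by
Knowledge Fission and Fusion, threshold matching selects exactly the prompts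
of the batch's own cluster. -/
theorem threshold_matching_selects_own_cluster
    {E : Type*} [NormedAddCommGroup E] [NormedSpace ℝ E]
    {I : Type*} (C : I → Set E) (δ Δ : ℝ)
    (hδ : 0 ≤ δ) (hΔ : 0 < Δ)
    (hne : ∀ i, (C i).Nonempty)
    (hintra : ∀ i, ∀ a ∈ C i, ∀ a' ∈ C i, ‖a - a'‖ ≤ δ)
    (hinter : ∀ i j, i ≠ j → ∀ a ∈ C i, ∀ b ∈ C j, Δ ≤ ‖a - b‖)
    (γ : ℝ) (hγ1 : δ < γ) (hγ2 : γ ≤ Δ - δ)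
    {m : ℕ} (P : Fin m → E) (κ : Fin m → I)
    (hP : ∀ k, P k ∈ convexHull ℝ (C (κ k)))
    (i : I) (x : E) (hx : x ∈ C i) :
    {k : Fin m | ‖x - P k‖ < γ} = {k : Fin m | κ k = i} := by
  ext k
  simp only [Set.mem_ofPred_eq]
  constructor
  · intro hk
    by_contra hne'
    obtain ⟨b, hb⟩ := hne (κ k)
    have hbP := norm_sub_le_of_mem_convexHull (hintra (κ k) b hb) (hP k)
    have hxb := hinter i (κ k) (Ne.symm hne') x hx b hb
    have htri := norm_sub_le_norm_sub_add_norm_sub x (P k) b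
    rw [norm_sub_rev (P k) b] at htri
    linarith
  · rintro rfl
    exact (norm_sub_le_of_mem_convexHull (hintra (κ k) x hx) (hP k)).trans_lt hγ1
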